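/- Let k be an infinite field and B a standard graded artinian k-algebra. Then B has the strong Lefschetz property if and only if B ⊗_k k[x]/(x^d) has the weak Lefschetz property for every integer d ≥ 1. -/

import Mathlib

open scoped BigOperators

/-- Multiplication by `a` is injective as a map on the subspace `V`. -/
def MulInjOn {k R : Type*} [Field k] [CommRing R] [Algebra k R]
    (V : Submodule k R) (a : R) : Prop :=
  ∀ v ∈ V, a * v = 0 → v = 0

/-- Multiplication by `a` maps the subspace `V` onto the subspace `W`. -/
def MulSurjOnto {k R : Type*} [Field k] [CommRing R] [Algebra k R]
    (V W : Submodule k R) (a : R) : Prop :=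
  ∀ w ∈ W, ∃ v ∈ V, a * v = w

/-- The multiplication map `·a : V → W` has full rank: it is injective or surjective. -/
def MulFullRank {k R : Type*} [Field k] [CommRing R] [Algebra k R]
    (V W : Submodule k R) (a : R) : Prop :=
  MulInjOn V a ∨ MulSurjOnto V W a

/-- `𝒜` is the grading of a standard graded artinian `k`-algebra structure on `R`:
the components form an internal direct sum, vanish in negative degrees, are
multiplicative, the degree-zero part is spanned by `1`, the algebra is generated in
degree one, and `R` is a finite-dimensional `k`-vector space (equivalently, artinian). -/
structure IsStdGradedArtinian (k : Type*) [Field k] (R : Type*) [CommRing R] [Algebra k R]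
    (𝒜 : ℤ → Submodule k R) : Prop where
  internal : DirectSum.IsInternal 𝒜
  one_mem : (1 : R) ∈ 𝒜 0
  mul_mem : ∀ {i j : ℤ} {a b : R}, a ∈ 𝒜 i → b ∈ 𝒜 j → a * b ∈ 𝒜 (i + j)
  neg_bot : ∀ i : ℤ, i < 0 → 𝒜 i = ⊥
  zero_spanOne : 𝒜 0 = Submodule.span k {(1 : R)}
  succ_eq : ∀ i : ℤ, 0 ≤ i → 𝒜 (i + 1) = 𝒜 1 * 𝒜 i
  finiteDim : FiniteDimensional k R

/-- `A` (graded by `ℬ`) is the extension `B ⊗ₖ k[x]/(x^d)` of `B` (graded by `𝒜`):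
`φ` is the canonical inclusion of `B`, `x` has degree one with `x^d = 0`, and each
graded component decomposes as `ℬ j = ⊕_{q=0}^{d-1} x^q · φ(𝒜 (j - q))`. -/
structure IsCIExtension {k B A : Type*} [Field k] [CommRing B] [Algebra k B]
    [CommRing A] [Algebra k A]
    (𝒜 : ℤ → Submodule k B) (ℬ : ℤ → Submodule k A)
    (φ : B →ₐ[k] A) (x : A) (d : ℕ) : Prop where
  map_mem : ∀ (j : ℤ) (b : B), b ∈ 𝒜 j → φ b ∈ ℬ j
  x_mem : x ∈ ℬ 1
  x_pow : x ^ d = 0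
  decomp_mem : ∀ (j : ℤ) (f : Fin d → B), (∀ q : Fin d, f q ∈ 𝒜 (j - ((q : ℕ) : ℤ))) →
    (∑ q : Fin d, x ^ (q : ℕ) * φ (f q)) ∈ ℬ j
  decomp_exists : ∀ (j : ℤ), ∀ c ∈ ℬ j, ∃ f : Fin d → B,
    (∀ q : Fin d, f q ∈ 𝒜 (j - ((q : ℕ) : ℤ))) ∧ c = ∑ q : Fin d, x ^ (q : ℕ) * φ (f q)
  decomp_unique : ∀ (j : ℤ) (f : Fin d → B), (∀ q : Fin d, f q ∈ 𝒜 (j - ((q : ℕ) : ℤ))) →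
    (∑ q : Fin d, x ^ (q : ℕ) * φ (f q)) = 0 → ∀ q : Fin d, f q = 0

/-- `A` (graded by `ℬ`) is the extension `B ⊗ₖ k[x₁,…,xₙ]/(x₁^{d₁},…,xₙ^{dₙ})` of `B`
(graded by `𝒜`). -/
structure IsMultiCIExtension {k B A : Type*} [Field k] [CommRing B] [Algebra k B]
    [CommRing A] [Algebra k A] {n : ℕ}
    (𝒜 : ℤ → Submodule k B) (ℬ : ℤ → Submodule k A)
    (φ : B →ₐ[k] A) (x : Fin n → A) (dv : Fin n → ℕ) : Prop where
  map_mem : ∀ (j : ℤ) (b : B), b ∈ 𝒜 j → φ b ∈ ℬ j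
  x_mem : ∀ m : Fin n, x m ∈ ℬ 1
  x_pow : ∀ m : Fin n, x m ^ dv m = 0
  decomp_mem : ∀ (j : ℤ) (f : ((m : Fin n) → Fin (dv m)) → B),
    (∀ e, f e ∈ 𝒜 (j - ∑ m : Fin n, ((e m : ℕ) : ℤ))) →
    (∑ e : (m : Fin n) → Fin (dv m), (∏ m : Fin n, x m ^ ((e m : ℕ))) * φ (f e)) ∈ ℬ j
  decomp_exists : ∀ (j : ℤ), ∀ c ∈ ℬ j, ∃ f : ((m : Fin n) → Fin (dv m)) → B,
    (∀ e, f e ∈ 𝒜 (j - ∑ m : Fin n, ((e m : ℕ) : ℤ))) ∧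
    c = ∑ e : (m : Fin n) → Fin (dv m), (∏ m : Fin n, x m ^ ((e m : ℕ))) * φ (f e)
  decomp_unique : ∀ (j : ℤ) (f : ((m : Fin n) → Fin (dv m)) → B),
    (∀ e, f e ∈ 𝒜 (j - ∑ m : Fin n, ((e m : ℕ) : ℤ))) →
    (∑ e : (m : Fin n) → Fin (dv m), (∏ m : Fin n, x m ^ ((e m : ℕ))) * φ (f e)) = 0 →
    ∀ e, f e = 0

/-- The weak Lefschetz property. -/
def HasWLP {k R : Type*} [Field k] [CommRing R] [Algebra k R]
    (𝒜 : ℤ → Submodule k R) : Prop :=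
  ∃ ℓ ∈ 𝒜 1, ∀ i : ℤ, 0 ≤ i → MulFullRank (𝒜 i) (𝒜 (i + 1)) ℓ

/-- The strong Lefschetz property. -/
def HasSLP {k R : Type*} [Field k] [CommRing R] [Algebra k R]
    (𝒜 : ℤ → Submodule k R) : Prop :=
  ∃ ℓ ∈ 𝒜 1, ∀ i : ℤ, 0 ≤ i → ∀ t : ℕ, 1 ≤ t → MulFullRank (𝒜 i) (𝒜 (i + t)) (ℓ ^ t)

/-- The Hilbert function of the graded algebra. -/
noncomputable def hilb {k R : Type*} [Field k] [CommRing R] [Algebra k R]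
    (𝒜 : ℤ → Submodule k R) (i : ℤ) : ℕ :=
  Module.finrank k (𝒜 i)

/-- The algebra is almost centered. -/
def AlmostCentered {k R : Type*} [Field k] [CommRing R] [Algebra k R]
    (𝒜 : ℤ → Submodule k R) : Prop :=
  ∀ i j : ℤ, i < j →
    (hilb 𝒜 i < hilb 𝒜 j → ∀ s : ℕ, hilb 𝒜 (i - s) ≤ hilb 𝒜 (j + s)) ∧
    (hilb 𝒜 j < hilb 𝒜 i → ∀ s : ℕ, hilb 𝒜 (j + s) ≤ hilb 𝒜 (i - s))

/-- `binomZ t j` is the binomial coefficient `t` choose `j` for an integer `j`,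
equal to `0` for `j < 0` or `j > t`. -/
def binomZ (t : ℕ) (j : ℤ) : ℤ := if 0 ≤ j then (t.choose j.toNat : ℤ) else 0

/-- The `(d-p) × (d-p)` integer matrix `C_{t,p,d}` whose `(r,c)` entry (with `1 ≤ r,c ≤ d-p`)
is `binom(t, d+1-r-c)`. -/
def Cmat (t p d : ℕ) : Matrix (Fin (d - p)) (Fin (d - p)) ℤ :=
  Matrix.of fun r c => binomZ t ((d : ℤ) - 1 - (r : ℕ) - (c : ℕ))

/-- The characteristic of `k` is zero, or a prime not dividing the integer `N`. -/
def CharCond (k : Type*) [Field k] (N : ℤ) : Prop :=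
  CharZero k ∨ ∃ p : ℕ, p.Prime ∧ CharP k p ∧ ¬ ((p : ℤ) ∣ N)


section Perturbation

variable {k R : Type*} [Field k] [CommRing R] [Algebra k R]

theorem exists_polynomial_eval_eq_linear_pow (u v : R) (t : ℕ) (f : R →ₗ[k] k) :
    ∃ p : Polynomial k, ∀ a : k, p.eval a = f ((u + a • v) ^ t) := by
  induction t generalizing f with
  | zero => exact ⟨Polynomial.C (f 1), fun a => by simp⟩
  | succ t ih =>
    obtain ⟨p, hp⟩ := ih (f ∘ₗ LinearMap.mulRight k u)
    obtain ⟨q, hq⟩ := ih (f ∘ₗ LinearMap.mulRight k v)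
    refine ⟨p + Polynomial.X * q, fun a => ?_⟩
    simp only [Polynomial.eval_add, Polynomial.eval_mul, Polynomial.eval_X, hp, hq,
      LinearMap.comp_apply, LinearMap.mulRight_apply, pow_succ, mul_add, map_add,
      mul_smul_comm, map_smul, smul_eq_mul]

theorem eventually_det_ne_zero {U : Type*} [AddCommGroup U] [Module k U]
    [FiniteDimensional k U] (P : R →ₗ[k] U) (S : U →ₗ[k] R) (u v : R) (t : ℕ)
    (h : P ∘ₗ LinearMap.mulLeft k (u ^ t) ∘ₗ S = LinearMap.id) :
    ∀ᶠ a : k in Filter.cofinite,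
      LinearMap.det (P ∘ₗ LinearMap.mulLeft k ((u + a • v) ^ t) ∘ₗ S) ≠ 0 := by
  classical
  let b := Module.finBasis k U
  have hpoly : ∀ i j, ∃ p : Polynomial k, ∀ a : k, p.eval a =
      LinearMap.toMatrix b b (P ∘ₗ LinearMap.mulLeft k ((u + a • v) ^ t) ∘ₗ S) i j := by
    intro i j
    obtain ⟨p, hp⟩ := exists_polynomial_eval_eq_linear_pow u v t
      (b.coord i ∘ₗ P ∘ₗ LinearMap.mulRight k (S (b j)))
    exact ⟨p, fun a => by simp [hp, LinearMap.toMatrix_apply]⟩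
  choose p hp using hpoly
  have hdet : ∀ a : k, (Matrix.of p).det.eval a =
      LinearMap.det (P ∘ₗ LinearMap.mulLeft k ((u + a • v) ^ t) ∘ₗ S) := by
    intro a
    rw [← LinearMap.det_toMatrix b, ← Polynomial.coe_evalRingHom, RingHom.map_det]
    congr 1
    ext i j
    simp [hp]
  have hne : (Matrix.of p).det ≠ 0 := by
    intro h0
    have h1 := hdet 0
    rw [zero_smul, add_zero, h, LinearMap.det_id, h0, Polynomial.eval_zero] at h1
    exact zero_ne_one h1
  have hfin : {a : k | (Matrix.of p).det.eval a = 0}.Finite :=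
    (Matrix.of p).det.rootSet_finite k |>.subset fun a ha => by
      simpa [Polynomial.mem_rootSet, hne] using ha
  filter_upwards [hfin.compl_mem_cofinite] with a ha h0
  exact ha ((hdet a).trans h0)

/-- Full rank is a generic condition along the affine line `u + a • v`. -/
theorem MulFullRank.eventually_line [FiniteDimensional k R] {V W : Submodule k R} {u v : R}
    {t : ℕ} (hVW : ∀ a : k, ∀ b ∈ V, (u + a • v) ^ t * b ∈ W)
    (h : MulFullRank V W (u ^ t)) :
    ∀ᶠ a : k in Filter.cofinite, MulFullRank V W ((u + a • v) ^ t) := by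
  rcases h with h | h
  · obtain ⟨L, hL⟩ := LinearMap.exists_leftInverse_of_injective
      (LinearMap.mulLeft k (u ^ t) ∘ₗ V.subtype) (LinearMap.ker_eq_bot'.2 fun b hb =>
        Subtype.ext (h b b.2 hb))
    filter_upwards [eventually_det_ne_zero L V.subtype u v t hL] with a ha
    refine Or.inl fun b hb hz => ?_
    by_contra hb0
    have hker := LinearMap.ker_eq_bot.2 (LinearMap.equivOfDetNeZero _ ha).injective
    have hzero := LinearMap.ker_eq_bot'.1 hker ⟨b, hb⟩ (by
      change L ((u + a • v) ^ t * b) = 0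
      rw [hz, map_zero])
    exact hb0 (congrArg Subtype.val hzero)
  · obtain ⟨P, hP⟩ := LinearMap.exists_leftInverse_of_injective W.subtype W.ker_subtype
    have hPw : ∀ w : R, ∀ hw : w ∈ W, P w = ⟨w, hw⟩ := fun w hw =>
      LinearMap.congr_fun hP ⟨w, hw⟩
    have hV : ∀ b ∈ V, u ^ t * b ∈ W := fun b hb => by simpa using hVW 0 b hb
    have hsurj : Function.Surjective (P ∘ₗ LinearMap.mulLeft k (u ^ t) ∘ₗ V.subtype) := by
      rintro ⟨w, hw⟩
      obtain ⟨b, hb, rfl⟩ := h w hw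
      exact ⟨⟨b, hb⟩, hPw _ hw⟩
    obtain ⟨S, hS⟩ := LinearMap.exists_rightInverse_of_surjective _
      (LinearMap.range_eq_top.2 hsurj)
    filter_upwards [eventually_det_ne_zero P (V.subtype ∘ₗ S) u v t hS] with a ha
    refine Or.inr fun w hw => ?_
    obtain ⟨y, hy⟩ := (LinearMap.equivOfDetNeZero _ ha).surjective ⟨w, hw⟩
    refine ⟨S y, (S y).2, ?_⟩
    have hy' : P ((u + a • v) ^ t * S y) = ⟨w, hw⟩ := hy
    rw [hPw _ (hVW a _ (S y).2)] at hy'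
    exact congrArg Subtype.val hy'

theorem MulFullRank.of_smul {V W : Submodule k R} {c : k} {z : R} (h : MulFullRank V W (c • z)) : MulFullRank V W z := by
  rcases h with h | h
  · exact Or.inl fun b hb hz => h b hb (by rw [smul_mul_assoc, hz, smul_zero])
  · refine Or.inr fun w hw => ?_
    obtain ⟨b, hb, rfl⟩ := h w hw
    exact ⟨c • b, V.smul_mem c hb, by rw [mul_smul_comm, smul_mul_assoc]⟩

end Perturbation

namespace IsStdGradedArtinian

variable {k R : Type*} [Field k] [CommRing R] [Algebra k R] {𝒜 : ℤ → Submodule k R}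

theorem pow_mem (hR : IsStdGradedArtinian k R 𝒜) {z : R} (hz : z ∈ 𝒜 1) (n : ℕ) :
    z ^ n ∈ 𝒜 n := by
  induction n with
  | zero => simpa using hR.one_mem
  | succ n ih =>
    rw [pow_succ, Nat.cast_succ]
    exact hR.mul_mem ih hz

theorem pow_mul_mem (hR : IsStdGradedArtinian k R 𝒜) {z b : R} (hz : z ∈ 𝒜 1) (n : ℕ)
    {i j : ℤ} (hb : b ∈ 𝒜 i) (hj : j = i + n) : z ^ n * b ∈ 𝒜 j := by
  rw [hj, add_comm]
  exact hR.mul_mem (hR.pow_mem hz n) hb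

theorem exists_forall_ge_eq_bot (hR : IsStdGradedArtinian k R 𝒜) :
    ∃ N : ℕ, ∀ i : ℤ, N ≤ i → 𝒜 i = ⊥ := by
  have := hR.finiteDim
  have hfin : {i | 𝒜 i ≠ ⊥}.Finite :=
    WellFoundedGT.finite_ne_bot_of_iSupIndep hR.internal.submodule_iSupIndep
  obtain ⟨M, hM⟩ := hfin.bddAbove
  refine ⟨(M + 1).toNat, fun i hi => ?_⟩
  by_contra h
  have := hM h
  omega

/-- If every power map between components has full rank for some linear form, then a single
linear form works for finitely many of them. -/
theorem exists_common_linear_form [Infinite k] (hR : IsStdGradedArtinian k R 𝒜)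
    (s : Finset (ℤ × ℕ))
    (h : ∀ p ∈ s, ∃ ℓ ∈ 𝒜 1, MulFullRank (𝒜 p.1) (𝒜 (p.1 + p.2)) (ℓ ^ p.2)) :
    ∃ ℓ ∈ 𝒜 1, ∀ p ∈ s, MulFullRank (𝒜 p.1) (𝒜 (p.1 + p.2)) (ℓ ^ p.2) := by
  classical
  have := hR.finiteDim
  induction s using Finset.induction_on with
  | empty => exact ⟨0, zero_mem _, by simp⟩
  | insert p s hp ih =>
    obtain ⟨ℓ₁, h₁, hs⟩ := ih fun q hq => h q (Finset.mem_insert_of_mem hq)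
    obtain ⟨ℓ₂, h₂, hp₂⟩ := h p (Finset.mem_insert_self p s)
    have hmaps : ∀ {u v : R}, u ∈ 𝒜 1 → v ∈ 𝒜 1 → ∀ (q : ℤ × ℕ) (a : k), ∀ b ∈ 𝒜 q.1,
        (u + a • v) ^ q.2 * b ∈ 𝒜 (q.1 + q.2) := fun hu hv q a b hb =>
      hR.pow_mul_mem (add_mem hu (Submodule.smul_mem _ a hv)) q.2 hb rfl
    have e₁ : ∀ᶠ a : k in Filter.cofinite, ∀ q ∈ s,
        MulFullRank (𝒜 q.1) (𝒜 (q.1 + q.2)) ((ℓ₁ + a • ℓ₂) ^ q.2) :=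
      (Filter.eventually_all_finset s).2 fun q hq => (hs q hq).eventually_line (hmaps h₁ h₂ q)
    have e₂ := hp₂.eventually_line (hmaps h₂ h₁ p)
    have e₃ : ∀ᶠ a : k in Filter.cofinite, a ≠ 0 :=
      (Set.finite_singleton (0 : k)).compl_mem_cofinite
    obtain ⟨a, ha₁, ha₂, ha⟩ :=
      ((inv_injective.tendsto_cofinite.eventually e₁).and (e₂.and e₃)).exists
    refine ⟨ℓ₁ + a⁻¹ • ℓ₂, add_mem h₁ (Submodule.smul_mem _ _ h₂), fun q hq => ?_⟩
    rcases Finset.mem_insert.1 hq with rfl | hq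
    · have hscale : ℓ₂ + a • ℓ₁ = a • (ℓ₁ + a⁻¹ • ℓ₂) := by
        rw [smul_add, smul_smul, mul_inv_cancel₀ ha, one_smul, add_comm]
      rw [hscale, smul_pow] at ha₂
      exact ha₂.of_smul
    · exact ha₁ q hq

theorem hasSLP_of_forall_exists [Infinite k] (hR : IsStdGradedArtinian k R 𝒜)
    (h : ∀ i : ℤ, 0 ≤ i → ∀ t : ℕ, 1 ≤ t →
      ∃ ℓ ∈ 𝒜 1, MulFullRank (𝒜 i) (𝒜 (i + t)) (ℓ ^ t)) : HasSLP 𝒜 := by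
  obtain ⟨N, hN⟩ := hR.exists_forall_ge_eq_bot
  obtain ⟨ℓ, hℓ, hall⟩ := hR.exists_common_linear_form
    (Finset.Icc (0 : ℤ) N ×ˢ Finset.Icc 1 N) (by
      rintro ⟨i, t⟩ hit
      simp only [Finset.mem_product, Finset.mem_Icc] at hit
      exact h i hit.1.1 t hit.2.1)
  refine ⟨ℓ, hℓ, fun i hi t ht => ?_⟩
  by_cases hlt : i + t < N
  · refine hall (i, t) ?_
    simp only [Finset.mem_product, Finset.mem_Icc]
    omega
  · refine Or.inr fun w hw => ⟨0, zero_mem _, ?_⟩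
    rw [hN _ (not_lt.1 hlt), Submodule.mem_bot] at hw
    rw [mul_zero, hw]

end IsStdGradedArtinian

namespace IsCIExtension

variable {k B A : Type*} [Field k] [CommRing B] [Algebra k B] [CommRing A] [Algebra k A]
  {𝒜 : ℤ → Submodule k B} {ℬ : ℤ → Submodule k A} {φ : B →ₐ[k] A} {x : A} {d : ℕ}

theorem pow_mul_map_mem (h : IsCIExtension 𝒜 ℬ φ x d) (hA : IsStdGradedArtinian k A ℬ)
    (n : ℕ) {i j : ℤ} {b : B} (hb : b ∈ 𝒜 i) (hj : j = i + n) : x ^ n * φ b ∈ ℬ j :=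
  hA.pow_mul_mem h.x_mem n (h.map_mem i b hb) hj

theorem exists_range_sum (h : IsCIExtension 𝒜 ℬ φ x d) {j : ℤ} {c : A} (hc : c ∈ ℬ j) :
    ∃ f : ℕ → B, (∀ q < d, f q ∈ 𝒜 (j - q)) ∧ c = ∑ q ∈ Finset.range d, x ^ q * φ (f q) := by
  obtain ⟨f, hf, rfl⟩ := h.decomp_exists j c hc
  refine ⟨fun q => if hq : q < d then f ⟨q, hq⟩ else 0, fun q hq => ?_, ?_⟩
  · simpa [hq] using hf ⟨q, hq⟩
  · rw [← Fin.sum_univ_eq_sum_range (fun q => x ^ q * φ (if hq : q < d then f ⟨q, hq⟩ else 0)) d]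
    simp

theorem eq_zero_of_range_sum (h : IsCIExtension 𝒜 ℬ φ x d) {j : ℤ} {f : ℕ → B}
    (hf : ∀ q < d, f q ∈ 𝒜 (j - q)) (hsum : ∑ q ∈ Finset.range d, x ^ q * φ (f q) = 0)
    {q : ℕ} (hq : q < d) : f q = 0 := by
  rw [← Fin.sum_univ_eq_sum_range (fun q => x ^ q * φ (f q)) d] at hsum
  exact h.decomp_unique j (fun q => f q) (fun q => hf q q.2) hsum ⟨q, hq⟩

theorem sub_mul_geom_sum (φ : B →ₐ[k] A) (x : A) (ℓ b : B) (n : ℕ) :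
    (x - φ ℓ) * ∑ q ∈ Finset.range n, x ^ q * φ (ℓ ^ (n - 1 - q) * b) =
      x ^ n * φ b - φ (ℓ ^ n * b) := by
  have hsum : ∑ q ∈ Finset.range n, x ^ q * φ (ℓ ^ (n - 1 - q) * b) =
      (∑ q ∈ Finset.range n, x ^ q * φ ℓ ^ (n - 1 - q)) * φ b := by
    rw [Finset.sum_mul]
    exact Finset.sum_congr rfl fun q _ => by rw [map_mul, map_pow, mul_assoc]
  rw [hsum, ← mul_assoc, (Commute.all x (φ ℓ)).mul_geom_sum₂, sub_mul, map_mul, map_pow]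

theorem geom_sum_mem (h : IsCIExtension 𝒜 ℬ φ x d) (hA : IsStdGradedArtinian k A ℬ)
    (hB : IsStdGradedArtinian k B 𝒜) {ℓ b : B} (hℓ : ℓ ∈ 𝒜 1) (n : ℕ) {j : ℤ}
    (hb : b ∈ 𝒜 (j + 1 - n)) :
    ∑ q ∈ Finset.range n, x ^ q * φ (ℓ ^ (n - 1 - q) * b) ∈ ℬ j := by
  refine sum_mem fun q hq => ?_
  have hq := Finset.mem_range.1 hq
  exact h.pow_mul_map_mem hA q (i := j - q) (hB.pow_mul_mem hℓ _ hb (by omega)) (by omega)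

/-- If `(x - φ ℓ) c` lies in the image of `B`, then `c` is a geometric sum determined by its
top coefficient. -/
theorem exists_eq_geom_sum (h : IsCIExtension 𝒜 ℬ φ x d) (hB : IsStdGradedArtinian k B 𝒜)
    (hd : 1 ≤ d) {ℓ w : B} (hℓ : ℓ ∈ 𝒜 1) {j : ℤ} (hw : w ∈ 𝒜 (j + 1)) {c : A} (hc : c ∈ ℬ j)
    (hcw : (x - φ ℓ) * c = φ w) :
    ∃ b ∈ 𝒜 (j + 1 - d), ℓ ^ d * b = -w ∧
      c = ∑ q ∈ Finset.range d, x ^ q * φ (ℓ ^ (d - 1 - q) * b) := by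
  obtain ⟨f, hf, rfl⟩ := h.exists_range_sum hc
  obtain ⟨e, rfl⟩ : ∃ e, d = e + 1 := ⟨d - 1, by omega⟩
  obtain ⟨p, hp_zero, hp_succ⟩ : ∃ p : ℕ → B, p 0 = -w ∧ ∀ q, p (q + 1) = f q :=
    ⟨fun q => Nat.casesOn q (-w) f, rfl, fun _ => rfl⟩
  let g : ℕ → B := fun q => p q - ℓ * f q
  have hg : ∀ q < e + 1, g q ∈ 𝒜 (j + 1 - q) := by
    intro q hq
    have hℓf : ℓ * f q ∈ 𝒜 (j + 1 - q) := by
      have := hB.mul_mem hℓ (hf q hq)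
      rwa [show (1 : ℤ) + (j - q) = j + 1 - q by ring] at this
    refine sub_mem ?_ hℓf
    cases q with
    | zero => simpa [hp_zero] using hw
    | succ q =>
      have := hf q (by omega)
      rwa [show j - (q : ℤ) = j + 1 - (q + 1 : ℕ) by push_cast; ring, ← hp_succ] at this
  have hsum : ∑ q ∈ Finset.range (e + 1), x ^ q * φ (g q) = 0 := by
    have hx := h.x_pow
    have h₁ : ∑ q ∈ Finset.range (e + 1), x ^ q * φ (p q) =
        x * (∑ q ∈ Finset.range (e + 1), x ^ q * φ (f q)) - φ w := by
      rw [Finset.sum_range_succ', Finset.sum_range_succ (fun q => x ^ q * φ (f q)), mul_add,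
        ← mul_assoc, ← pow_succ', hx, Finset.mul_sum]
      simp only [pow_succ', mul_assoc, pow_zero, hp_zero, hp_succ, map_neg]
      ring
    have h₂ : ∑ q ∈ Finset.range (e + 1), x ^ q * φ (ℓ * f q) =
        φ ℓ * ∑ q ∈ Finset.range (e + 1), x ^ q * φ (f q) := by
      rw [Finset.mul_sum]
      exact Finset.sum_congr rfl fun q _ => by rw [map_mul]; ring
    simp only [g, map_sub, mul_sub, Finset.sum_sub_distrib]
    rw [h₁, h₂, ← hcw]
    ring
  have hzero : ∀ q < e + 1, g q = 0 := fun q hq => h.eq_zero_of_range_sum hg hsum hq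
  have hrec : ∀ q < e, f q = ℓ * f (q + 1) := fun q hq =>
    (hp_succ q).symm.trans (sub_eq_zero.1 (hzero (q + 1) (by omega)))
  have hzw : ℓ * f 0 = -w := (sub_eq_zero.1 (hzero 0 (by omega))).symm.trans hp_zero
  have hpow : ∀ m ≤ e, f (e - m) = ℓ ^ m * f e := by
    intro m
    induction m with
    | zero => simp
    | succ m ih =>
      intro hm
      rw [hrec (e - (m + 1)) (by omega), show e - (m + 1) + 1 = e - m by omega, ih (by omega),
        pow_succ', mul_assoc]
  refine ⟨f e, ?_, ?_, Finset.sum_congr rfl fun q hq => ?_⟩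
  · have := hf e (by omega)
    rwa [show j - (e : ℤ) = j + 1 - (e + 1 : ℕ) by push_cast; ring] at this
  · rw [pow_succ', mul_assoc, ← hpow e le_rfl, Nat.sub_self, hzw]
  · have hq := Finset.mem_range.1 hq
    rw [Nat.add_sub_cancel, ← hpow (e - q) (by omega), Nat.sub_sub_self (by omega)]

/-- Multiplication by `x - φ ℓ` on the extension has full rank exactly when multiplication by
`ℓ ^ d` on the corresponding components of the base has full rank. -/
theorem mulFullRank_sub_iff (h : IsCIExtension 𝒜 ℬ φ x d) (hA : IsStdGradedArtinian k A ℬ)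
    (hB : IsStdGradedArtinian k B 𝒜) (hd : 1 ≤ d) {ℓ : B} (hℓ : ℓ ∈ 𝒜 1) (j : ℤ) :
    MulFullRank (ℬ j) (ℬ (j + 1)) (x - φ ℓ) ↔
      MulFullRank (𝒜 (j + 1 - d)) (𝒜 (j + 1)) (ℓ ^ d) := by
  refine or_congr ⟨fun hinj b hb hz => ?_, fun hinj c hc hz => ?_⟩
    ⟨fun hsurj w hw => ?_, fun hsurj w hw => ?_⟩
  · have hsum := hinj _ (h.geom_sum_mem hA hB hℓ d hb) (by
      rw [sub_mul_geom_sum, h.x_pow, hz, zero_mul, map_zero, sub_zero])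
    have := h.eq_zero_of_range_sum (f := fun q => ℓ ^ (d - 1 - q) * b) (j := j)
      (fun q hq => hB.pow_mul_mem hℓ _ hb (by omega)) hsum (q := d - 1) (by omega)
    simpa using this
  · obtain ⟨b, hb, hbw, rfl⟩ := h.exists_eq_geom_sum hB hd hℓ (zero_mem _) hc
      (by rw [hz, map_zero])
    rw [hinj b hb (by rw [hbw, neg_zero])]
    simp
  · obtain ⟨c, hc, hcw⟩ := hsurj (φ w) (h.map_mem _ w hw)
    obtain ⟨b, hb, hbw, -⟩ := h.exists_eq_geom_sum hB hd hℓ hw hc hcw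
    exact ⟨-b, neg_mem hb, by rw [mul_neg, hbw, neg_neg]⟩
  · have hmap : ∀ b ∈ 𝒜 (j + 1), ∃ v ∈ ℬ j, (x - φ ℓ) * v = φ b := by
      intro b hb
      obtain ⟨b, hb', rfl⟩ := hsurj b hb
      refine ⟨-_, neg_mem (h.geom_sum_mem hA hB hℓ d hb'), ?_⟩
      rw [mul_neg, sub_mul_geom_sum, h.x_pow, zero_mul, zero_sub, neg_neg]
    obtain ⟨f, hf, rfl⟩ := h.exists_range_sum hw
    have hterm : ∀ q ∈ Finset.range d, ∃ v ∈ ℬ j, (x - φ ℓ) * v = x ^ q * φ (f q) := by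
      intro q hq
      have hfq := hf q (Finset.mem_range.1 hq)
      obtain ⟨v, hv, hvw⟩ := hmap (ℓ ^ q * f q) (hB.pow_mul_mem hℓ q hfq (by omega))
      refine ⟨_, add_mem (h.geom_sum_mem hA hB hℓ q hfq) hv, ?_⟩
      rw [mul_add, sub_mul_geom_sum, hvw, sub_add_cancel]
    choose! v hv hvw using hterm
    exact ⟨_, sum_mem hv, by rw [Finset.mul_sum]; exact Finset.sum_congr rfl hvw⟩

theorem exists_linear_form_eq (h : IsCIExtension 𝒜 ℬ φ x d) (hB : IsStdGradedArtinian k B 𝒜)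
    {z : A} (hz : z ∈ ℬ 1) : ∃ ℓ ∈ 𝒜 1, ∃ c : k, z = φ ℓ + c • x := by
  obtain ⟨f, hf, rfl⟩ := h.exists_range_sum hz
  rcases d with _ | _ | d
  · exact ⟨0, zero_mem _, 0, by simp⟩
  · exact ⟨f 0, by simpa using hf 0 (by omega), 0, by simp⟩
  · have hf₁ := hf 1 (by omega)
    rw [Nat.cast_one, sub_self, hB.zero_spanOne] at hf₁
    obtain ⟨c, hc⟩ := Submodule.mem_span_singleton.1 hf₁
    refine ⟨f 0, by simpa using hf 0 (by omega), c, ?_⟩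
    have hrest : ∑ q ∈ Finset.range d, x ^ (q + 1 + 1) * φ (f (q + 1 + 1)) = 0 := by
      refine Finset.sum_eq_zero fun q hq => ?_
      have hq := Finset.mem_range.1 hq
      have := hf (q + 1 + 1) (by omega)
      rw [hB.neg_bot _ (by push_cast; omega), Submodule.mem_bot] at this
      rw [this, map_zero, mul_zero]
    rw [Finset.sum_range_succ', Finset.sum_range_succ', hrest, ← hc]
    simp [add_comm]

theorem hasWLP_of_hasSLP (h : IsCIExtension 𝒜 ℬ φ x d) (hA : IsStdGradedArtinian k A ℬ)
    (hB : IsStdGradedArtinian k B 𝒜) (hd : 1 ≤ d) (hS : HasSLP 𝒜) : HasWLP ℬ := by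
  obtain ⟨ℓ, hℓ, hfull⟩ := hS
  refine ⟨x - φ ℓ, sub_mem h.x_mem (h.map_mem 1 ℓ hℓ), fun j _ => ?_⟩
  rw [h.mulFullRank_sub_iff hA hB hd hℓ]
  by_cases hneg : j + 1 - d < 0
  · refine Or.inl fun b hb _ => ?_
    rwa [hB.neg_bot _ hneg, Submodule.mem_bot] at hb
  · have := hfull (j + 1 - d) (not_lt.1 hneg) d hd
    rwa [sub_add_cancel] at this

theorem exists_mulFullRank_pow [Infinite k] (h : IsCIExtension 𝒜 ℬ φ x d)
    (hA : IsStdGradedArtinian k A ℬ) (hB : IsStdGradedArtinian k B 𝒜) (hd : 1 ≤ d)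
    (hW : HasWLP ℬ) {i : ℤ} (hi : 0 ≤ i) :
    ∃ ℓ ∈ 𝒜 1, MulFullRank (𝒜 i) (𝒜 (i + d)) (ℓ ^ d) := by
  have := hA.finiteDim
  obtain ⟨z, hz, hfull⟩ := hW
  obtain ⟨ℓ, hℓ, c, rfl⟩ := h.exists_linear_form_eq hB hz
  have hj := hfull (i + d - 1) (by omega)
  rw [← pow_one (φ ℓ + c • x)] at hj
  have hline := hj.eventually_line (v := x) fun a b hb =>
    hA.pow_mul_mem (add_mem hz (Submodule.smul_mem _ a h.x_mem)) 1 hb (by simp)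
  have hne : ∀ᶠ a : k in Filter.cofinite, a ≠ -c :=
    (Set.finite_singleton (-c)).compl_mem_cofinite
  obtain ⟨a, ha, hac⟩ := (hline.and hne).exists
  have hac : c + a ≠ 0 := fun h0 => hac (eq_neg_of_add_eq_zero_right h0)
  have hscale : φ ℓ + c • x + a • x = (c + a) • (x - φ (-(c + a)⁻¹ • ℓ)) := by
    rw [map_smul, smul_sub, smul_smul, mul_neg, mul_inv_cancel₀ hac, add_smul, neg_one_smul]
    ring
  have hmem : -(c + a)⁻¹ • ℓ ∈ 𝒜 1 := Submodule.smul_mem _ _ hℓ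
  rw [pow_one, hscale] at ha
  have := (h.mulFullRank_sub_iff hA hB hd hmem _).1 ha.of_smul
  rw [sub_add_cancel, add_sub_cancel_right] at this
  exact ⟨_, hmem, this⟩

end IsCIExtension

section Extension

variable {k B A : Type*} [Field k] [CommRing B] [Algebra k B] [CommRing A] [Algebra k A]
  [Algebra B A] [IsScalarTower k B A] {d : ℕ}

/-- The grading induced on a free extension of `B` by a grading of `B`, where the basis vector
of index `q` is given degree `q`. -/
noncomputable def basisGrading (𝒜 : ℤ → Submodule k B) (b : Module.Basis (Fin d) B A) (j : ℤ) :
    Submodule k A :=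
  ⨅ q : Fin d, (𝒜 (j - ((q : ℕ) : ℤ))).comap ((b.coord q).restrictScalars k)

theorem mem_basisGrading {𝒜 : ℤ → Submodule k B} {b : Module.Basis (Fin d) B A} {j : ℤ} {c : A} :
    c ∈ basisGrading 𝒜 b j ↔ ∀ q : Fin d, b.repr c q ∈ 𝒜 (j - ((q : ℕ) : ℤ)) := by
  simp [basisGrading, Submodule.mem_iInf]

variable {𝒜 : ℤ → Submodule k B} {b : Module.Basis (Fin d) B A} {x : A}

theorem eq_sum_pow_mul_repr (hb : ∀ q : Fin d, b q = x ^ (q : ℕ)) (c : A) :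
    c = ∑ q : Fin d, x ^ (q : ℕ) * algebraMap B A (b.repr c q) := by
  conv_lhs => rw [← b.sum_repr c]
  exact Finset.sum_congr rfl fun q _ => by rw [Algebra.smul_def, hb, mul_comm]

theorem repr_sum_pow_mul (hb : ∀ q : Fin d, b q = x ^ (q : ℕ)) (f : Fin d → B) (r : Fin d) :
    b.repr (∑ q : Fin d, x ^ (q : ℕ) * algebraMap B A (f q)) r = f r := by
  have h : ∑ q : Fin d, x ^ (q : ℕ) * algebraMap B A (f q) = ∑ q : Fin d, f q • b q :=
    Finset.sum_congr rfl fun q _ => by rw [Algebra.smul_def, hb, mul_comm]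
  rw [h, b.repr_sum_self f]

theorem pow_mul_mem_basisGrading (hb : ∀ q : Fin d, b q = x ^ (q : ℕ)) (hx : x ^ d = 0) (n : ℕ)
    {i j : ℤ} {a : B} (ha : a ∈ 𝒜 i) (hj : j = i + n) :
    x ^ n * algebraMap B A a ∈ basisGrading 𝒜 b j := by
  by_cases hn : n < d
  · have h : x ^ n * algebraMap B A a = a • b ⟨n, hn⟩ := by
      rw [Algebra.smul_def, hb, mul_comm]
    rw [mem_basisGrading, h]
    intro q
    rw [map_smul, b.repr_self, Finsupp.smul_apply, Finsupp.single_apply]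
    split_ifs with hq
    · rw [← hq, hj]
      simpa using ha
    · simp
  · rw [pow_eq_zero_of_le (not_lt.1 hn) hx, zero_mul]
    exact zero_mem _

theorem basisGrading_internal (hB : IsStdGradedArtinian k B 𝒜)
    (hb : ∀ q : Fin d, b q = x ^ (q : ℕ)) (hx : x ^ d = 0) :
    DirectSum.IsInternal (basisGrading 𝒜 b) := by
  rw [DirectSum.isInternal_submodule_iff_iSupIndep_and_iSup_eq_top]
  constructor
  · rw [iSupIndep_def]
    intro j
    rw [Submodule.disjoint_def]
    intro c hc hc'
    refine b.ext_elem fun q => ?_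
    have hle : ⨆ i, ⨆ (_ : i ≠ j), basisGrading 𝒜 b i ≤
        (⨆ i, ⨆ (_ : i ≠ j - ((q : ℕ) : ℤ)), 𝒜 i).comap ((b.coord q).restrictScalars k) := by
      refine iSup₂_le fun i hi y hy => ?_
      exact Submodule.mem_iSup_of_mem (i - ((q : ℕ) : ℤ))
        (Submodule.mem_iSup_of_mem (by omega) (mem_basisGrading.1 hy q))
    have hdisj := iSupIndep_def.1 hB.internal.submodule_iSupIndep (j - ((q : ℕ) : ℤ))
    simpa using (Submodule.disjoint_def.1 hdisj) _ (mem_basisGrading.1 hc q) (hle hc')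
  · refine eq_top_iff.2 fun c _ => ?_
    rw [eq_sum_pow_mul_repr hb c]
    refine sum_mem fun q _ => ?_
    have hle : ⨆ i, 𝒜 i ≤ (⨆ j, basisGrading 𝒜 b j).comap
        (LinearMap.mulLeft k (x ^ (q : ℕ)) ∘ₗ (IsScalarTower.toAlgHom k B A).toLinearMap) :=
      iSup_le fun i a ha => Submodule.mem_iSup_of_mem (i + (q : ℕ))
        (pow_mul_mem_basisGrading hb hx q ha rfl)
    rw [hB.internal.submodule_iSup_eq_top] at hle
    exact hle (Submodule.mem_top (x := b.repr c q))

theorem isStdGradedArtinian_basisGrading (hB : IsStdGradedArtinian k B 𝒜)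
    (hb : ∀ q : Fin d, b q = x ^ (q : ℕ)) (hx : x ^ d = 0) :
    IsStdGradedArtinian k A (basisGrading 𝒜 b) := by
  have hone : (1 : A) ∈ basisGrading 𝒜 b 0 := by
    simpa using pow_mul_mem_basisGrading hb hx 0 hB.one_mem (j := 0) (by simp)
  have hmul : ∀ {i j : ℤ} {y z : A}, y ∈ basisGrading 𝒜 b i → z ∈ basisGrading 𝒜 b j →
      y * z ∈ basisGrading 𝒜 b (i + j) := by
    intro i j y z hy hz
    rw [eq_sum_pow_mul_repr hb y, eq_sum_pow_mul_repr hb z, Finset.sum_mul_sum]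
    refine sum_mem fun q _ => sum_mem fun r _ => ?_
    rw [mul_mul_mul_comm, ← pow_add, ← map_mul]
    refine pow_mul_mem_basisGrading hb hx _
      (hB.mul_mem (mem_basisGrading.1 hy q) (mem_basisGrading.1 hz r)) ?_
    push_cast
    ring
  refine ⟨basisGrading_internal hB hb hx, hone, hmul, fun i hi => ?_, ?_, fun i hi => ?_, ?_⟩
  · refine (Submodule.eq_bot_iff _).2 fun c hc => b.ext_elem fun q => ?_
    have := mem_basisGrading.1 hc q
    rw [hB.neg_bot _ (by omega), Submodule.mem_bot] at this
    simpa using this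
  · refine le_antisymm (fun c hc => ?_) ((Submodule.span_singleton_le_iff_mem _ _).2 hone)
    rw [eq_sum_pow_mul_repr hb c]
    refine sum_mem fun q _ => ?_
    have hq := mem_basisGrading.1 hc q
    by_cases h0 : (q : ℕ) = 0
    · rw [h0, Nat.cast_zero, sub_zero, hB.zero_spanOne] at hq
      obtain ⟨a, ha⟩ := Submodule.mem_span_singleton.1 hq
      rw [← ha, h0, pow_zero, one_mul, Algebra.algebraMap_eq_smul_one, smul_assoc, one_smul]
      exact Submodule.smul_mem _ _ (Submodule.mem_span_singleton_self _)
    · rw [hB.neg_bot _ (by omega), Submodule.mem_bot] at hq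
      rw [hq, map_zero, mul_zero]
      exact zero_mem _
  · refine le_antisymm (fun c hc => ?_) (Submodule.mul_le.2 fun y hy z hz => ?_)
    · rw [eq_sum_pow_mul_repr hb c]
      refine sum_mem fun q _ => ?_
      have hq := mem_basisGrading.1 hc q
      obtain h0 | ⟨n, hn⟩ : (q : ℕ) = 0 ∨ ∃ n, (q : ℕ) = n + 1 := by
        rcases (q : ℕ) with _ | n
        · exact Or.inl rfl
        · exact Or.inr ⟨n, rfl⟩
      · rw [h0, Nat.cast_zero, sub_zero, hB.succ_eq i hi] at hq
        rw [h0, pow_zero, one_mul]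
        refine Submodule.mul_induction_on (C := fun a => algebraMap B A a ∈ _) hq
          (fun y hy z hz => ?_) fun y z hy hz => ?_
        · rw [map_mul]
          refine Submodule.mul_mem_mul ?_ ?_
          · simpa using pow_mul_mem_basisGrading hb hx 0 hy (j := 1) (by simp)
          · simpa using pow_mul_mem_basisGrading hb hx 0 hz (j := i) (by simp)
        · rw [map_add]
          exact add_mem hy hz
      · rw [hn, pow_succ', mul_assoc]
        refine Submodule.mul_mem_mul ?_ (pow_mul_mem_basisGrading hb hx n hq ?_)
        · simpa using pow_mul_mem_basisGrading hb hx 1 hB.one_mem (j := 1) (by simp)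
        · rw [hn]
          push_cast
          ring
    · rw [add_comm]
      exact hmul hy hz
  · have := hB.finiteDim
    have : Module.Finite B A := Module.Finite.of_basis b
    exact Module.Finite.trans B A

theorem isCIExtension_basisGrading (hB : IsStdGradedArtinian k B 𝒜)
    (hb : ∀ q : Fin d, b q = x ^ (q : ℕ)) (hx : x ^ d = 0) :
    IsCIExtension 𝒜 (basisGrading 𝒜 b) (IsScalarTower.toAlgHom k B A) x d where
  map_mem j a ha := by simpa using pow_mul_mem_basisGrading hb hx 0 ha (j := j) (by simp)
  x_mem := by simpa using pow_mul_mem_basisGrading hb hx 1 hB.one_mem (j := 1) (by simp)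
  x_pow := hx
  decomp_mem j f hf := by
    rw [mem_basisGrading]
    intro q
    have := repr_sum_pow_mul hb f q
    simpa only [IsScalarTower.coe_toAlgHom', this] using hf q
  decomp_exists j c hc := ⟨fun q => b.repr c q, mem_basisGrading.1 hc, eq_sum_pow_mul_repr hb c⟩
  decomp_unique j f _ hsum q := by
    have := repr_sum_pow_mul hb f q
    simp only [IsScalarTower.coe_toAlgHom'] at hsum
    rw [← this, hsum, map_zero, Finsupp.zero_apply]

end Extension

theorem exists_isCIExtension {k B : Type} [Field k] [CommRing B] [Nontrivial B] [Algebra k B]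
    {𝒜 : ℤ → Submodule k B} (hB : IsStdGradedArtinian k B 𝒜) (d : ℕ) :
    ∃ (A : Type) (_ : CommRing A) (_ : Algebra k A) (ℬ : ℤ → Submodule k A) (φ : B →ₐ[k] A)
      (x : A), IsStdGradedArtinian k A ℬ ∧ IsCIExtension 𝒜 ℬ φ x d := by
  let g : Polynomial B := Polynomial.X ^ d
  have hg : g.Monic := Polynomial.monic_X_pow d
  let pb := AdjoinRoot.powerBasis' hg
  have hdim : pb.dim = d := Polynomial.natDegree_X_pow d
  let b : Module.Basis (Fin d) B (AdjoinRoot g) := pb.basis.reindex (finCongr hdim)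
  have hb : ∀ q : Fin d, b q = AdjoinRoot.root g ^ (q : ℕ) := fun q => by
    simp [b, pb]
  have hx : AdjoinRoot.root g ^ d = 0 := by
    have := AdjoinRoot.mk_self (f := g)
    rwa [map_pow, AdjoinRoot.mk_X] at this
  exact ⟨AdjoinRoot g, inferInstance, inferInstance, basisGrading 𝒜 b, _, AdjoinRoot.root g,
    isStdGradedArtinian_basisGrading hB hb hx, isCIExtension_basisGrading hB hb hx⟩

/-- Over an infinite field `k`, a standard graded artinian `k`-algebra
`B` has the strong Lefschetz property if and only if `B ⊗ₖ k[x]/(x^d)` has the weak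
Lefschetz property for every `d ≥ 1`. -/
theorem statement_13 {k B : Type} [Field k] [Infinite k]
    [CommRing B] [Algebra k B]
    (𝒜 : ℤ → Submodule k B) (hB : IsStdGradedArtinian k B 𝒜) :
    HasSLP 𝒜 ↔
      ∀ (d : ℕ), 1 ≤ d →
        ∀ (A : Type) [CommRing A] [Algebra k A],
          ∀ (ℬ : ℤ → Submodule k A) (φ : B →ₐ[k] A) (x : A),
            IsStdGradedArtinian k A ℬ → IsCIExtension 𝒜 ℬ φ x d → HasWLP ℬ := by
  refine ⟨fun hS d hd A _ _ ℬ φ x hA h => h.hasWLP_of_hasSLP hA hB hd hS, fun hW => ?_⟩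
  cases subsingleton_or_nontrivial B
  · exact ⟨0, zero_mem _, fun i _ t _ => Or.inl fun b _ _ => Subsingleton.elim b 0⟩
  · refine hB.hasSLP_of_forall_exists fun i hi t ht => ?_
    obtain ⟨A, _, _, ℬ, φ, x, hA, h⟩ := exists_isCIExtension hB t
    exact h.exists_mulFullRank_pow hA hB ht (hW t ht A ℬ φ x hA h) hi
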